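/- arXiv:1803.01877 — 3 statements merged into one kernel-verified Lean document; each statement's English description precedes it below -/
import Mathlib

section
/- Let k be a positive even integer and n ≥ 1. For every continuously differentiable function V : ℝⁿ → ℝ that is homogeneous of degree k, and for every scalar ε > 0, there exist an even nonnegative integer r and a homogeneous polynomial p of degree r + k such that the homogeneous rational function x ↦ p(x)/‖x‖^r satisfies max_{x ∈ S^{n−1}} |V(x) − p(x)/‖x‖^r| ≤ ε and max_{x ∈ S^{n−1}} ‖∇V(x) − ∇(p/‖·‖^r)(x)‖₂ ≤ ε, where S^{n−1} is the unit sphere of ℝⁿ. -/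
open MvPolynomial MeasureTheory

section helpers

variable {n : ℕ}

lemma aux_cont (q : MvPolynomial (Fin n) ℝ) :
    Continuous (fun y : EuclideanSpace ℝ (Fin n) => MvPolynomial.eval (fun i => y i) q) :=
  (MvPolynomial.continuous_eval q).comp (by fun_prop)

lemma aux_conv_poly (q : MvPolynomial (Fin n) ℝ) :
    ∀ f : EuclideanSpace ℝ (Fin n) → ℝ, Continuous f → HasCompactSupport f →
      ∃ P : MvPolynomial (Fin n) ℝ, ∀ x : EuclideanSpace ℝ (Fin n),
        ∫ t, f t * MvPolynomial.eval (fun i => (x - t) i) q = MvPolynomial.eval (fun i => x i) P := by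
  have hint : ∀ (q : MvPolynomial (Fin n) ℝ) (f : EuclideanSpace ℝ (Fin n) → ℝ), Continuous f →
      HasCompactSupport f → ∀ x : EuclideanSpace ℝ (Fin n),
      Integrable (fun t => f t * MvPolynomial.eval (fun i => (x - t) i) q) := by
    intro q f hf hc x
    refine Continuous.integrable_of_hasCompactSupport ?_ hc.mul_right
    exact hf.mul ((aux_cont q).comp (by fun_prop))
  induction q using MvPolynomial.induction_on with
  | C a =>
    intro f hf hc
    refine ⟨C ((∫ t, f t) * a), fun x => ?_⟩
    simp [integral_mul_const]
  | add p q hp hq =>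
    intro f hf hc
    obtain ⟨P, hP⟩ := hp f hf hc
    obtain ⟨Q, hQ⟩ := hq f hf hc
    refine ⟨P + Q, fun x => ?_⟩
    rw [map_add, ← hP, ← hQ, ← integral_add (hint _ _ hf hc _) (hint _ _ hf hc _)]
    congr 1; ext t; rw [map_add]; ring
  | mul_X p j hp =>
    intro f hf hc
    obtain ⟨P, hP⟩ := hp f hf hc
    have hf2 : Continuous (fun t : EuclideanSpace ℝ (Fin n) => f t * t j) := by fun_prop
    have hc2 : HasCompactSupport (fun t : EuclideanSpace ℝ (Fin n) => f t * t j) := hc.mul_right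
    obtain ⟨Q, hQ⟩ := hp _ hf2 hc2
    refine ⟨P * X j - Q, fun x => ?_⟩
    rw [map_sub, map_mul, eval_X, ← hP, ← hQ, ← integral_mul_const,
      ← integral_sub ((hint _ _ hf hc _).mul_const _) (hint _ _ hf2 hc2 _)]
    congr 1; ext t; rw [map_mul, eval_X, PiLp.sub_apply]; ring

lemma aux_sw (g : EuclideanSpace ℝ (Fin n) → ℝ) (hg : Continuous g) (R η : ℝ) (hη : 0 < η) :
    ∃ q : MvPolynomial (Fin n) ℝ, ∀ z : EuclideanSpace ℝ (Fin n), ‖z‖ ≤ R →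
      |g z - MvPolynomial.eval (fun i => z i) q| ≤ η := by
  let co : Fin n → C(EuclideanSpace ℝ (Fin n), ℝ) := fun i => ⟨fun y => y i, by fun_prop⟩
  let A : Subalgebra ℝ C(EuclideanSpace ℝ (Fin n), ℝ) := (MvPolynomial.aeval co).range
  have hA : A.SeparatesPoints := by
    intro x y hxy
    have : ∃ i, x i ≠ y i := by
      by_contra! h
      exact hxy (by ext i; exact h i)
    obtain ⟨i, hi⟩ := this
    exact ⟨co i, ⟨co i, ⟨X i, by simp⟩, rfl⟩, hi⟩
  obtain ⟨g', ⟨q, hq⟩, h⟩ :=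
    ContinuousMap.exists_mem_subalgebra_near_continuous_of_isCompact_of_separatesPoints hA
      ⟨g, hg⟩ (isCompact_closedBall (0 : EuclideanSpace ℝ (Fin n)) R) hη
  refine ⟨q, fun z hz => ?_⟩
  have h1 := h z (by simpa using hz)
  have h2 : g' z = MvPolynomial.eval (fun i => z i) q := by
    rw [← hq]
    clear h h1 hq
    change (aeval co q) z = _
    induction q using MvPolynomial.induction_on with
    | C a => simp
    | add p q hp hq => simp [hp, hq]
    | mul_X p j hp => simp [hp, co]
  rw [h2, Real.norm_eq_abs, abs_sub_comm] at h1
  exact h1.le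

lemma aux_moll {F' : Type*} [NormedAddCommGroup F'] [NormedSpace ℝ F'] [CompleteSpace F']
    (F : EuclideanSpace ℝ (Fin n) → F') (hF : Continuous F) (hc : HasCompactSupport F)
    (ε : ℝ) (hε : 0 < ε) :
    ∃ δ > 0, ∀ φ : ContDiffBump (0 : EuclideanSpace ℝ (Fin n)), φ.rOut ≤ δ → ∀ x,
      ‖(∫ t, φ.normed volume (x - t) • F t) - F x‖ ≤ ε := by
  have hu := hc.uniformContinuous_of_continuous hF
  obtain ⟨δ, hδ, h⟩ := Metric.uniformContinuous_iff.1 hu ε hε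
  refine ⟨δ, hδ, fun φ hφ x => ?_⟩
  have := φ.dist_normed_convolution_le (μ := volume) (g := F) (x₀ := x) (ε := ε)
    hF.aestronglyMeasurable
    (fun y hy => (h (lt_of_lt_of_le (Metric.mem_ball.1 hy) hφ)).le)
  rw [convolution_lsmul_swap, dist_eq_norm] at this
  exact this

lemma aux_pert {F' : Type*} [NormedAddCommGroup F'] [NormedSpace ℝ F']
    (F : EuclideanSpace ℝ (Fin n) → F') (hF : Continuous F) (hc : HasCompactSupport F)
    (R ε : ℝ) (hε : 0 < ε) (hR : ∀ t, F t ≠ 0 → ‖t‖ ≤ R) :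
    ∃ η > 0, ∀ g q : EuclideanSpace ℝ (Fin n) → ℝ, Continuous g → Continuous q →
      (∀ z, ‖z‖ ≤ R + 1 → |g z - q z| ≤ η) → ∀ x, ‖x‖ ≤ 1 →
      ‖(∫ t, g (x - t) • F t) - ∫ t, q (x - t) • F t‖ ≤ ε := by
  have hI : 0 ≤ ∫ t, ‖F t‖ := integral_nonneg fun _ => norm_nonneg _
  refine ⟨ε / ((∫ t, ‖F t‖) + 1), by positivity, fun g q hg hq h x hx => ?_⟩
  have hint : ∀ g : EuclideanSpace ℝ (Fin n) → ℝ, Continuous g →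
      Integrable (fun t => g (x - t) • F t) := fun g hg =>
    Continuous.integrable_of_hasCompactSupport (by fun_prop) hc.smul_left
  rw [← integral_sub (hint g hg) (hint q hq)]
  have hFi : Integrable (fun t => ‖F t‖) :=
    (hF.integrable_of_hasCompactSupport hc).norm
  calc _ ≤ ∫ t, ε / ((∫ t, ‖F t‖) + 1) * ‖F t‖ := by
        refine norm_integral_le_of_norm_le (hFi.const_mul _) (Filter.Eventually.of_forall fun t => ?_)
        rw [← sub_smul, norm_smul, Real.norm_eq_abs]
        by_cases h0 : F t = 0
        · simp [h0]
        · refine mul_le_mul_of_nonneg_right (h _ ?_) (norm_nonneg _)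
          have := norm_sub_le x t
          have := hR t h0
          linarith
    _ = ε / ((∫ t, ‖F t‖) + 1) * ∫ t, ‖F t‖ := integral_const_mul _ _
    _ ≤ ε := by
        rw [div_mul_eq_mul_div, div_le_iff₀ (by positivity)]
        nlinarith

lemma aux_approx (f : EuclideanSpace ℝ (Fin n) → ℝ) (hf : ContDiff ℝ 1 f)
    (hc : HasCompactSupport f) (ε : ℝ) (hε : 0 < ε) :
    ∃ P : MvPolynomial (Fin n) ℝ, ∀ x : EuclideanSpace ℝ (Fin n), ‖x‖ ≤ 1 →
      |f x - MvPolynomial.eval (fun i => x i) P| ≤ ε ∧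
      ∃ D : EuclideanSpace ℝ (Fin n) →L[ℝ] ℝ, HasFDerivAt (fun y : EuclideanSpace ℝ (Fin n) =>
        MvPolynomial.eval (fun i => y i) P) D x ∧ ‖fderiv ℝ f x - D‖ ≤ ε := by
  have hf' : Continuous (fderiv ℝ f) := hf.continuous_fderiv (by norm_num)
  have hc' : HasCompactSupport (fderiv ℝ f) := hc.fderiv ℝ
  obtain ⟨R1, hR1⟩ := hc.isBounded.exists_norm_le
  obtain ⟨R2, hR2⟩ := hc'.isBounded.exists_norm_le
  obtain ⟨δ1, hδ1, h1⟩ := aux_moll f hf.continuous hc (ε / 2) (by positivity)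
  obtain ⟨δ2, hδ2, h2⟩ := aux_moll _ hf' hc' (ε / 2) (by positivity)
  obtain ⟨η1, hη1, k1⟩ := aux_pert f hf.continuous hc (max R1 R2) (ε / 2) (by positivity)
    (fun t ht => (hR1 t (subset_tsupport _ ht)).trans (le_max_left _ _))
  obtain ⟨η2, hη2, k2⟩ := aux_pert _ hf' hc' (max R1 R2) (ε / 2) (by positivity)
    (fun t ht => (hR2 t (subset_tsupport _ ht)).trans (le_max_right _ _))
  have hδ : 0 < min δ1 δ2 := lt_min hδ1 hδ2
  let φ : ContDiffBump (0 : EuclideanSpace ℝ (Fin n)) := ⟨min δ1 δ2 / 2, min δ1 δ2,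
    by positivity, by linarith⟩
  have hφc : Continuous (φ.normed volume) := φ.continuous_normed
  obtain ⟨q, hq⟩ := aux_sw (φ.normed volume) hφc (max R1 R2 + 1) (min η1 η2) (lt_min hη1 hη2)
  obtain ⟨P, hP⟩ := aux_conv_poly q f hf.continuous hc
  have hPc : (fun y : EuclideanSpace ℝ (Fin n) => MvPolynomial.eval (fun i => y i) P) =
      convolution f (fun z : EuclideanSpace ℝ (Fin n) => MvPolynomial.eval (fun i => z i) q)
        (ContinuousLinearMap.lsmul ℝ ℝ) volume := by
    ext y
    rw [← hP y]
    rfl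
  refine ⟨P, fun x hx => ⟨?_, _, hPc ▸ hc.hasFDerivAt_convolution_left
    (ContinuousLinearMap.lsmul ℝ ℝ) hf (aux_cont q).locallyIntegrable x, ?_⟩⟩
  · have a1 := h1 φ (min_le_left _ _) x
    have a2 := k1 _ _ hφc (aux_cont q) (fun z hz => (hq z hz).trans (min_le_left _ _)) x hx
    have : MvPolynomial.eval (fun i => x i) P =
        ∫ t, (MvPolynomial.eval (fun i => (x - t) i) q) • f t := by
      rw [← hP]; congr 1; ext t; rw [smul_eq_mul, mul_comm]
    rw [← this, Real.norm_eq_abs, abs_le] at a2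
    rw [Real.norm_eq_abs, abs_le] at a1
    rw [abs_le]
    constructor <;> linarith
  · have a1 := h2 φ (min_le_right _ _) x
    have a2 := k2 _ _ hφc (aux_cont q) (fun z hz => (hq z hz).trans (min_le_right _ _)) x hx
    have : (convolution (fderiv ℝ f)
        (fun z : EuclideanSpace ℝ (Fin n) => MvPolynomial.eval (fun i => z i) q)
        ((ContinuousLinearMap.lsmul ℝ ℝ).precompL (EuclideanSpace ℝ (Fin n))) volume) x =
        ∫ t, (MvPolynomial.eval (fun i => (x - t) i) q) • fderiv ℝ f t := by
      rw [convolution_def]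
      congr 1; ext t v
      simp [mul_comm]
    rw [this]
    rw [← norm_neg, neg_sub]
    have := norm_sub_le_norm_sub_add_norm_sub
      (∫ t, (MvPolynomial.eval (fun i => (x - t) i) q) • fderiv ℝ f t)
      (∫ t, φ.normed volume (x - t) • fderiv ℝ f t) (fderiv ℝ f x)
    rw [norm_sub_rev] at a2
    linarith

lemma aux_approx' (V : EuclideanSpace ℝ (Fin n) → ℝ) (hV : ContDiff ℝ 1 V) (ε : ℝ) (hε : 0 < ε) :
    ∃ P : MvPolynomial (Fin n) ℝ, ∀ x : EuclideanSpace ℝ (Fin n), ‖x‖ ≤ 1 →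
      ∃ D : EuclideanSpace ℝ (Fin n) →L[ℝ] ℝ, HasFDerivAt (fun y : EuclideanSpace ℝ (Fin n) =>
        V y - MvPolynomial.eval (fun i => y i) P) D x ∧ ‖D‖ ≤ ε ∧
        |V x - MvPolynomial.eval (fun i => x i) P| ≤ ε := by
  let χ : ContDiffBump (0 : EuclideanSpace ℝ (Fin n)) := ⟨2, 3, by norm_num, by norm_num⟩
  obtain ⟨P, hP⟩ := aux_approx (fun y => χ y * V y) (χ.contDiff.mul hV)
    (χ.hasCompactSupport.mul_right) ε hε
  refine ⟨P, fun x hx => ?_⟩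
  obtain ⟨h1, D, hD, h2⟩ := hP x hx
  have hx2 : x ∈ Metric.ball (0 : EuclideanSpace ℝ (Fin n)) χ.rIn := by
    simp [χ]; linarith
  have he : (fun y => χ y * V y) =ᶠ[nhds x] V := by
    filter_upwards [χ.eventuallyEq_one_of_mem_ball hx2] with y hy
    simp [hy]
  rw [he.fderiv_eq] at h2
  have h3 : χ x * V x = V x := he.eq_of_nhds
  rw [h3] at h1
  exact ⟨_, ((hV.differentiable (by norm_num)) x).hasFDerivAt.sub hD, h2, h1⟩

lemma aux_rad (h : EuclideanSpace ℝ (Fin n) → ℝ) (k : ℕ) (x : EuclideanSpace ℝ (Fin n))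
    (hx : ‖x‖ = 1) (D : EuclideanSpace ℝ (Fin n) →L[ℝ] ℝ) (hD : HasFDerivAt h D x) :
    ∃ D' : EuclideanSpace ℝ (Fin n) →L[ℝ] ℝ, HasFDerivAt (fun y => ‖y‖ ^ k * h (‖y‖⁻¹ • y)) D' x ∧ ‖D'‖ ≤ k * |h x| + 2 * ‖D‖ := by
  have hN : HasFDerivAt (fun y : EuclideanSpace ℝ (Fin n) => ‖y‖) (innerSL ℝ x) x := by
    have h1 := (hasStrictFDerivAt_norm_sq x).hasFDerivAt.sqrt (by simp [hx])
    have h2 : (fun y : EuclideanSpace ℝ (Fin n) => √(‖y‖ ^ 2)) = fun y => ‖y‖ := by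
      ext y; exact Real.sqrt_sq (norm_nonneg _)
    rw [h2] at h1
    refine h1.congr_fderiv ?_
    ext v
    simp [hx]
  have hNi : HasFDerivAt (fun y : EuclideanSpace ℝ (Fin n) => ‖y‖⁻¹) (-innerSL ℝ x) x := by
    have := (hasDerivAt_inv (x := ‖x‖) (by simp [hx])).comp_hasFDerivAt x hN
    refine HasFDerivAt.congr_fderiv this ?_
    ext v
    simp [hx]
  have hz := hNi.smul (hasFDerivAt_id x)
  have hzx : ‖x‖⁻¹ • x = x := by simp [hx]
  have hh := HasFDerivAt.comp x (f := fun y : EuclideanSpace ℝ (Fin n) => ‖y‖⁻¹ • y) (g := h)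
    (by rw [hzx]; exact hD) hz
  have hfin := (hN.pow k).mul hh
  refine ⟨_, hfin, ?_⟩
  refine ContinuousLinearMap.opNorm_le_bound _ (by positivity) fun v => ?_
  have hi : |inner ℝ x v| ≤ ‖v‖ := by
    have := abs_real_inner_le_norm x v
    rwa [hx, one_mul] at this
  have hDv : |D (v - inner ℝ x v • x)| ≤ ‖D‖ * (2 * ‖v‖) := by
    refine (D.le_opNorm _).trans (mul_le_mul_of_nonneg_left ?_ (norm_nonneg _))
    refine (norm_sub_le _ _).trans ?_
    rw [norm_smul, hx, Real.norm_eq_abs]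
    linarith
  have hval : ∀ A : ℝ, A = D (v - inner ℝ x v • x) + k * (h x * inner ℝ x v) →
      |A| ≤ (k * |h x| + 2 * ‖D‖) * ‖v‖ := by
    rintro _ rfl
    refine (abs_add_le _ _).trans ?_
    rw [abs_mul, abs_mul, Nat.abs_cast]
    have : (k : ℝ) * (|h x| * |inner ℝ x v|) ≤ k * (|h x| * ‖v‖) := by gcongr
    nlinarith
  rw [Real.norm_eq_abs]
  apply hval
  simp [hx]
  ring

lemma aux_hom_eval (p : MvPolynomial (Fin n) ℝ) (m : ℕ) (hp : p.IsHomogeneous m) (c : ℝ)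
    (x : Fin n → ℝ) : MvPolynomial.eval (fun i => c * x i) p = c ^ m * MvPolynomial.eval x p := by
  rw [eval_eq, eval_eq, Finset.mul_sum]
  refine Finset.sum_congr rfl fun d hd => ?_
  have hdeg : ∑ i ∈ d.support, d i = m := by
    have := hp (mem_support_iff.1 hd)
    rw [Finsupp.weight_apply, Finsupp.sum] at this
    simpa using this
  simp_rw [mul_pow]
  rw [Finset.prod_mul_distrib, Finset.prod_pow_eq_pow_sum, hdeg]
  ring

/-- Homogenisation of the even part of `P` using powers of the squared norm. -/
lemma aux_homog (P : MvPolynomial (Fin n) ℝ) (k : ℕ) (hke : Even k) :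
    ∃ (r : ℕ) (p : MvPolynomial (Fin n) ℝ), Even r ∧ p.IsHomogeneous (r + k) ∧
      ∀ y : EuclideanSpace ℝ (Fin n), y ≠ 0 →
        MvPolynomial.eval (fun i => y i) p / ‖y‖ ^ r =
        ‖y‖ ^ k * ((MvPolynomial.eval (fun i => (‖y‖⁻¹ • y) i) P +
          MvPolynomial.eval (fun i => (-(‖y‖⁻¹ • y)) i) P) / 2) := by
  obtain ⟨a, ha⟩ := hke
  let d := P.totalDegree
  let s : MvPolynomial (Fin n) ℝ := ∑ j, X j ^ 2
  have hs : s.IsHomogeneous 2 := IsHomogeneous.sum _ _ _ fun j _ => isHomogeneous_X_pow j 2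
  have hse : ∀ y : EuclideanSpace ℝ (Fin n), MvPolynomial.eval (fun i => y i) s = ‖y‖ ^ 2 := by
    intro y
    simp [s, EuclideanSpace.norm_sq_eq]
  let p : MvPolynomial (Fin n) ℝ := ∑ i ∈ Finset.range (d + 1),
    if Even i then homogeneousComponent i P * s ^ (d + a - i / 2) else 0
  refine ⟨2 * d, p, by simp, ?_, ?_⟩
  · refine IsHomogeneous.sum _ _ _ fun i hi => ?_
    split_ifs with he
    · have := (homogeneousComponent_isHomogeneous i P).mul (hs.pow (d + a - i / 2))
      convert this using 1
      have := Finset.mem_range.1 hi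
      obtain ⟨b, hb⟩ := he
      omega
    · exact isHomogeneous_zero _ _ _
  · intro y hy
    have hy0 : ‖y‖ ≠ 0 := norm_ne_zero_iff.2 hy
    have hev : ∀ c : ℝ, MvPolynomial.eval (fun i => (c • y) i) P =
        ∑ i ∈ Finset.range (d + 1),
          c ^ i * MvPolynomial.eval (fun i => y i) (homogeneousComponent i P) := by
      intro c
      conv_lhs => rw [← sum_homogeneousComponent P, map_sum]
      refine Finset.sum_congr rfl fun i _ => ?_
      rw [← aux_hom_eval _ i (homogeneousComponent_isHomogeneous i P)]
      rfl
    rw [← neg_smul, hev, hev, ← Finset.sum_add_distrib, Finset.sum_div, Finset.mul_sum,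
      map_sum, Finset.sum_div]
    refine Finset.sum_congr rfl fun i hi => ?_
    have hid := Finset.mem_range.1 hi
    split_ifs with he
    · rw [map_mul, map_pow, hse, ← pow_mul, he.neg_pow]
      obtain ⟨b, hb⟩ := he
      have e1 : 2 * d + k = 2 * (d + a - i / 2) + i := by omega
      rw [div_eq_iff (by positivity), inv_pow]
      have e2 : ‖y‖ ^ k * ‖y‖ ^ (2 * d) = ‖y‖ ^ (2 * (d + a - i / 2)) * ‖y‖ ^ i := by
        rw [← pow_add, ← pow_add, ← e1, add_comm]
      field_simp
      linear_combination (-2 * MvPolynomial.eval (fun i => y i) (homogeneousComponent i P)) * e2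
    · rw [Nat.not_even_iff_odd] at he
      rw [he.neg_pow]
      simp

end helpers

/-- Let `k` be a positive even integer and `n ≥ 1`. For every continuously
differentiable `V : ℝⁿ → ℝ` homogeneous of degree `k` and every `ε > 0`, there exist an even
nonnegative integer `r` and a homogeneous polynomial `p` of degree `r + k` such that on the unit
sphere, `|V(x) - p(x)/‖x‖^r| ≤ ε` and `‖∇V(x) - ∇(p/‖·‖^r)(x)‖ ≤ ε`. -/
theorem stmt0 (n k : ℕ) (hn : 1 ≤ n) (hk : 0 < k) (hke : Even k)
    (V : EuclideanSpace ℝ (Fin n) → ℝ) (hV : ContDiff ℝ 1 V)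
    (hVhom : ∀ (c : ℝ) (x : EuclideanSpace ℝ (Fin n)), V (c • x) = c ^ k * V x)
    (ε : ℝ) (hε : 0 < ε) :
    ∃ (r : ℕ) (p : MvPolynomial (Fin n) ℝ), Even r ∧ p.IsHomogeneous (r + k) ∧
      (∀ x : EuclideanSpace ℝ (Fin n), ‖x‖ = 1 →
        |V x - MvPolynomial.eval (fun i => x i) p / ‖x‖ ^ r| ≤ ε) ∧
      (∀ x : EuclideanSpace ℝ (Fin n), ‖x‖ = 1 →
        ‖gradient V x -
          gradient (fun y : EuclideanSpace ℝ (Fin n) =>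
            MvPolynomial.eval (fun i => y i) p / ‖y‖ ^ r) x‖ ≤ ε) := by
  obtain ⟨P, hP⟩ := aux_approx' V hV (ε / (k + 2)) (by positivity)
  obtain ⟨r, p, hr, hp, hpe⟩ := aux_homog P k hke
  have hVneg : ∀ x, V (-x) = V x := fun x => by
    have := hVhom (-1) x
    rwa [neg_one_smul, hke.neg_one_pow, one_mul] at this
  have hle : ε / (k + 2) ≤ ε := div_le_self hε.le (by linarith [(Nat.cast_nonneg k : (0:ℝ) ≤ k)])
  refine ⟨r, p, hr, hp, fun x hx => ?_, fun x hx => ?_⟩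
  · have hx0 : x ≠ 0 := by rintro rfl; simp at hx
    obtain ⟨_, _, _, h1⟩ := hP x hx.le
    obtain ⟨_, _, _, h2⟩ := hP (-x) (by simp [hx])
    rw [hVneg] at h2
    rw [hpe x hx0]
    simp only [hx, inv_one, one_smul, one_pow, one_mul]
    rw [abs_le] at h1 h2 ⊢
    constructor <;> linarith
  · have hx0 : x ≠ 0 := by rintro rfl; simp at hx
    obtain ⟨D1, hD1, hn1, h1⟩ := hP x hx.le
    obtain ⟨D2, hD2, hn2, h2⟩ := hP (-x) (by simp [hx])
    have hD2' := HasFDerivAt.comp x (f := fun y : EuclideanSpace ℝ (Fin n) => -y) hD2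
      (hasFDerivAt_id x).neg
    obtain ⟨A, hA, hAn⟩ := aux_rad _ k x hx _ hD1
    obtain ⟨B, hB, hBn⟩ := aux_rad _ k x hx _ hD2'
    have hVd := ((hV.differentiable (by norm_num)) x).hasFDerivAt
    have hW : HasFDerivAt (fun y : EuclideanSpace ℝ (Fin n) =>
            MvPolynomial.eval (fun i => y i) p / ‖y‖ ^ r)
            (fderiv ℝ V x - (2⁻¹ : ℝ) • (A + B)) x := by
      refine (hVd.sub ((hA.add hB).const_smul (2⁻¹ : ℝ))).congr_of_eventuallyEq ?_
      filter_upwards [isOpen_ne.mem_nhds hx0] with y hy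
      have hy0 : ‖y‖ ≠ 0 := norm_ne_zero_iff.2 hy
      have hVy : V y = ‖y‖ ^ k * V (‖y‖⁻¹ • y) := by
        rw [hVhom, ← mul_assoc, ← mul_pow, mul_inv_cancel₀ hy0, one_pow, one_mul]
      rw [hpe y hy]
      simp only [Pi.sub_apply, Pi.add_apply, Pi.smul_apply, Function.comp_apply, hVneg, smul_eq_mul]
      rw [hVy]
      ring
    have hDn : ‖D2.comp (-ContinuousLinearMap.id ℝ (EuclideanSpace ℝ (Fin n)))‖ ≤ ε / (k + 2) := by
      simpa using hn2
    unfold gradient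
    rw [← map_sub, LinearIsometryEquiv.norm_map, hW.fderiv, sub_sub_cancel, norm_smul]
    have hk2 : (k : ℝ) * (ε / (k + 2)) + 2 * (ε / (k + 2)) = ε := by field_simp
    have t1 : (k : ℝ) * |V x - MvPolynomial.eval (fun i => x i) P| ≤ k * (ε / (k + 2)) := by gcongr
    have t2 : (k : ℝ) * |V (-x) - MvPolynomial.eval (fun i => (-x) i) P| ≤ k * (ε / (k + 2)) := by
      gcongr
    have := norm_add_le A B
    simp only [Function.comp_apply] at hAn hBn
    rw [Real.norm_eq_abs, abs_of_pos (by norm_num)]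
    linarith
end

section
/- There exist no two univariate polynomials p̃ and q̃ with real coefficients, with q̃ non-constant, such that p̃(x²) = q̃((x⁴+1)/(x²+1)) for all x ∈ ℝ. -/
/-- there are no univariate real polynomials `p̃`, `q̃`, with `q̃` non-constant,
such that `p̃(x²) = q̃((x⁴+1)/(x²+1))` for all real `x`. -/
theorem stmt12 :
    ¬ ∃ (pt qt : Polynomial ℝ), 0 < qt.natDegree ∧
        ∀ x : ℝ, pt.eval (x ^ 2) = qt.eval ((x ^ 4 + 1) / (x ^ 2 + 1)) := by
  rintro ⟨p, q, hq, h⟩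
  have key : p * (Polynomial.X + 1) ^ q.natDegree =
      ∑ i ∈ Finset.range (q.natDegree + 1), Polynomial.C (q.coeff i) *
        (Polynomial.X ^ 2 + 1) ^ i * (Polynomial.X + 1) ^ (q.natDegree - i) := by
    apply Polynomial.eq_of_infinite_eval_eq
    apply (Set.Ici_infinite (0 : ℝ)).mono
    intro t ht
    have ht0 : (0 : ℝ) ≤ t := ht
    have h1 := h (Real.sqrt t)
    have h4 : Real.sqrt t ^ 4 = t ^ 2 := by
      rw [show Real.sqrt t ^ 4 = (Real.sqrt t ^ 2) ^ 2 by ring, Real.sq_sqrt ht0]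
    rw [h4, Real.sq_sqrt ht0] at h1
    have hne : t + 1 ≠ 0 := by positivity
    simp only [Set.mem_setOf_eq, Polynomial.eval_mul, Polynomial.eval_pow, Polynomial.eval_add,
      Polynomial.eval_X, Polynomial.eval_one, Polynomial.eval_finset_sum, Polynomial.eval_C]
    rw [h1, Polynomial.eval_eq_sum_range, Finset.sum_mul]
    apply Finset.sum_congr rfl
    intro i hi
    have hi' : i ≤ q.natDegree := by
      have := Finset.mem_range.mp hi
      omega
    obtain ⟨k, hk⟩ := Nat.exists_eq_add_of_le hi'
    rw [hk, Nat.add_sub_cancel_left, div_pow, pow_add]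
    field_simp
  have h2 := congrArg (Polynomial.eval (-1)) key
  simp only [Polynomial.eval_mul, Polynomial.eval_pow, Polynomial.eval_add,
      Polynomial.eval_X, Polynomial.eval_one, Polynomial.eval_finset_sum, Polynomial.eval_C] at h2
  rw [Finset.sum_range_succ, Finset.sum_eq_zero] at h2
  · rw [neg_add_cancel, zero_pow hq.ne'] at h2
    have h3 : q.coeff q.natDegree ≠ 0 := by
      intro h0
      have : q = 0 := Polynomial.leadingCoeff_eq_zero.mp h0
      simp [this] at hq
    norm_num at h2
    simp [h2] at hq
  · intro i hi
    have := Finset.mem_range.mp hi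
    rw [neg_add_cancel, zero_pow (by omega), mul_zero]
end

section
/- Let C : ℝⁿ → ℝ be a polynomial that is even (C(−x) = C(x) for all x ∈ ℝⁿ), and let k be a positive even integer. Then there exist an even nonnegative integer r and a homogeneous polynomial p of degree r + k such that ‖x‖^k C(x/‖x‖) = p(x)/‖x‖^r for all x ≠ 0. -/
open MvPolynomial

lemma aux_hom_scale {n j : ℕ} {q : MvPolynomial (Fin n) ℝ} (hq : q.IsHomogeneous j)
    (t : ℝ) (y : Fin n → ℝ) :
    MvPolynomial.eval (fun i => t * y i) q = t ^ j * MvPolynomial.eval y q := by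
  rw [MvPolynomial.eval_eq, MvPolynomial.eval_eq, Finset.mul_sum]
  refine Finset.sum_congr rfl fun e he => ?_
  have h := hq (MvPolynomial.mem_support_iff.mp he)
  have h2 : ∑ i ∈ e.support, e i = j := by
    rw [← h, Finsupp.weight_apply, Finsupp.sum]
    simp
  simp only [mul_pow, Finset.prod_mul_distrib, Finset.prod_pow_eq_pow_sum, h2]
  ring

/-- if `C : ℝⁿ → ℝ` is an even polynomial and `k` a positive even integer, then
there exist an even nonnegative integer `r` and a homogeneous polynomial `p` of degree `r + k`
such that `‖x‖^k C(x/‖x‖) = p(x)/‖x‖^r` for all `x ≠ 0`. -/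
theorem stmt18 (n k : ℕ) (hk : 0 < k) (hke : Even k) (C : MvPolynomial (Fin n) ℝ)
    (hCeven : ∀ x : Fin n → ℝ, MvPolynomial.eval (-x) C = MvPolynomial.eval x C) :
    ∃ (r : ℕ) (p : MvPolynomial (Fin n) ℝ), Even r ∧ p.IsHomogeneous (r + k) ∧
      ∀ x : EuclideanSpace ℝ (Fin n), x ≠ 0 →
        ‖x‖ ^ k * MvPolynomial.eval (fun i => (‖x‖⁻¹ • x) i) C
          = MvPolynomial.eval (fun i => x i) p / ‖x‖ ^ r := by
  obtain ⟨l, rfl⟩ := hke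
  set d := C.totalDegree with hd
  have hsum : ∀ y : Fin n → ℝ, eval y C
      = ∑ j ∈ Finset.range (d + 1), eval y (homogeneousComponent j C) := by
    intro y
    conv_lhs => rw [← sum_homogeneousComponent C]
    rw [map_sum]
  have heven : ∀ y : Fin n → ℝ, eval y C
      = ∑ j ∈ Finset.range (d + 1),
          if Even j then eval y (homogeneousComponent j C) else 0 := by
    intro y
    have h1 : eval (-y) C = ∑ j ∈ Finset.range (d + 1),
        (-1) ^ j * eval y (homogeneousComponent j C) := by
      rw [hsum]
      refine Finset.sum_congr rfl fun j _ => ?_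
      rw [← aux_hom_scale (homogeneousComponent_isHomogeneous j C)]
      congr 2
      ext i
      simp
    have h2 : eval y C = (eval y C + eval (-y) C) / 2 := by rw [hCeven]; ring
    rw [h2, h1, hsum, ← Finset.sum_add_distrib, Finset.sum_div]
    refine Finset.sum_congr rfl fun j _ => ?_
    split_ifs with hj
    · rw [hj.neg_one_pow]; ring
    · rw [(Nat.not_even_iff_odd.mp hj).neg_one_pow]; ring
  have hS : (∑ i : Fin n, (X i : MvPolynomial (Fin n) ℝ) ^ 2).IsHomogeneous 2 :=
    IsHomogeneous.sum _ _ _ fun i _ => isHomogeneous_X_pow i 2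
  refine ⟨2 * d, ∑ j ∈ Finset.range (d + 1),
    if Even j then homogeneousComponent j C * (∑ i : Fin n, X i ^ 2) ^ (d + l - j / 2) else 0,
    even_two_mul d, ?_, ?_⟩
  · refine IsHomogeneous.sum _ _ _ fun j hj => ?_
    split_ifs with h
    · convert (homogeneousComponent_isHomogeneous j C).mul (hS.pow (d + l - j / 2)) using 1
      rw [Finset.mem_range] at hj
      obtain ⟨a, rfl⟩ := h
      omega
    · exact isHomogeneous_zero _ _ _
  · intro x hx
    have hn : ‖x‖ ≠ 0 := norm_ne_zero_iff.mpr hx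
    rw [eq_div_iff (pow_ne_zero _ hn), heven, map_sum, Finset.mul_sum, Finset.sum_mul]
    refine Finset.sum_congr rfl fun j hj => ?_
    rw [Finset.mem_range] at hj
    split_ifs with h
    · have h3 : eval (fun i => x i) (∑ i : Fin n, (X i : MvPolynomial (Fin n) ℝ) ^ 2)
          = ‖x‖ ^ 2 := by
        simp [EuclideanSpace.norm_sq_eq]
      have h4 := aux_hom_scale (homogeneousComponent_isHomogeneous j C) ‖x‖
        (fun i => (‖x‖⁻¹ • x) i)
      have h5 : (fun i => ‖x‖ * (‖x‖⁻¹ • x) i) = fun i => x i := by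
        ext i
        simp [hn]
      rw [h5] at h4
      rw [map_mul, map_pow, h3, h4]
      have h6 : l + l + 2 * d = j + 2 * (d + l - j / 2) := by
        obtain ⟨a, rfl⟩ := h
        omega
      have h7 := congrArg (fun m => ‖x‖ ^ m) h6
      simp only [pow_add _ (l + l), pow_add _ j, pow_mul _ 2 (d + l - j / 2)] at h7
      linear_combination (eval (fun i => (‖x‖⁻¹ • x) i) (homogeneousComponent j C)) * h7
    · simp
end
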